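/- arXiv:2309.02587 — 4 statements merged into one kernel-verified Lean document; each statement's English description precedes it below -/
import Mathlib

section
/- Let p be a prime number, K a field of characteristic p, and L an algebraic, purely inseparable field extension of K. Then for every valuation subring V of K there exists a unique valuation subring W of L lying over V, i.e. with W ∩ K = V; moreover this W is given explicitly by W = { a ∈ L : there exists n ∈ ℕ with a^{p^n} ∈ V }. -/
theorem ValuationSubring.mem_of_pow_mem_aux {F : Type*} [Field F] (W : ValuationSubring F) (x : F)
    (k : ℕ) (hk : k ≠ 0) (h : x ^ k ∈ W) : x ∈ W := by
  rcases W.mem_or_inv_mem x with h1 | h1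
  · exact h1
  · by_cases hx : x = 0
    · rw [hx]; exact W.zero_mem
    obtain ⟨m, rfl⟩ := Nat.exists_eq_succ_of_ne_zero hk
    have : x = x ^ (m + 1) * (x⁻¹) ^ m := by
      rw [inv_pow, pow_succ']
      field_simp
    rw [this]
    exact W.mul_mem _ _ h (pow_mem h1 m)

theorem exists_lift_aux {p : ℕ} {K L : Type*} [Field K] [Field L] [Algebra K L]
    (V : ValuationSubring K) {a : L} {n : ℕ} (m : ℕ)
    (h : ∃ b ∈ V, algebraMap K L b = a ^ p ^ n) :
    ∃ b ∈ V, algebraMap K L b = a ^ p ^ (n + m) := by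
  obtain ⟨b, hb, e⟩ := h
  exact ⟨b ^ p ^ m, pow_mem hb _, by rw [map_pow, e, ← pow_mul, pow_add]⟩

/-- Let `p` be a prime, `K` a field of characteristic `p`, and `L` an algebraic, purely
inseparable extension of `K` (every `x : L` has `x ^ p ^ n ∈ K` for some `n`).  Then every
valuation subring `V` of `K` admits a unique valuation subring `W` of `L` lying over it
(`W ∩ K = V`), and this `W` is `{a : L | ∃ n, a ^ p ^ n ∈ V}`. -/
theorem unique_valuationSubring_over_purely_inseparable
    (p : ℕ) (hp : p.Prime) (K L : Type*) [Field K] [Field L] [CharP K p]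
    [Algebra K L] [Algebra.IsAlgebraic K L]
    (hins : ∀ x : L, ∃ n : ℕ, x ^ p ^ n ∈ (algebraMap K L).range)
    (V : ValuationSubring K) :
    (∃! W : ValuationSubring L, W.comap (algebraMap K L) = V) ∧
      (∀ W : ValuationSubring L, W.comap (algebraMap K L) = V →
        ∀ a : L, a ∈ W ↔ ∃ n : ℕ, ∃ b ∈ V, algebraMap K L b = a ^ p ^ n) := by
  have hp0 : ∀ n : ℕ, p ^ n ≠ 0 := fun n => pow_ne_zero n hp.ne_zero
  haveI : Fact p.Prime := ⟨hp⟩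
  haveI : CharP L p := charP_of_injective_algebraMap (algebraMap K L).injective p
  have key : ∀ W : ValuationSubring L, W.comap (algebraMap K L) = V →
        ∀ a : L, a ∈ W ↔ ∃ n : ℕ, ∃ b ∈ V, algebraMap K L b = a ^ p ^ n := by
    rintro W rfl a
    constructor
    · intro ha
      obtain ⟨n, b, hb⟩ := hins a
      refine ⟨n, b, ?_, hb⟩
      rw [ValuationSubring.mem_comap, hb]
      exact pow_mem ha _
    · rintro ⟨n, b, hb, e⟩
      rw [ValuationSubring.mem_comap, e] at hb
      exact W.mem_of_pow_mem_aux a _ (hp0 n) hb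
  refine ⟨?_, key⟩
  let W : ValuationSubring L :=
    { carrier := {a | ∃ n : ℕ, ∃ b ∈ V, algebraMap K L b = a ^ p ^ n}
      mul_mem' := by
        rintro x y ⟨n, hx⟩ ⟨m, hy⟩
        obtain ⟨b, hb, e⟩ := exists_lift_aux V m hx
        obtain ⟨c, hc, f⟩ := exists_lift_aux V n hy
        rw [add_comm m n] at f
        exact ⟨n + m, b * c, V.mul_mem _ _ hb hc, by rw [map_mul, e, f, mul_pow]⟩
      one_mem' := ⟨0, 1, V.one_mem, by simp⟩
      add_mem' := by
        rintro x y ⟨n, hx⟩ ⟨m, hy⟩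
        obtain ⟨b, hb, e⟩ := exists_lift_aux V m hx
        obtain ⟨c, hc, f⟩ := exists_lift_aux V n hy
        rw [add_comm m n] at f
        exact ⟨n + m, b + c, V.add_mem _ _ hb hc, by rw [map_add, e, f, add_pow_char_pow]⟩
      zero_mem' := ⟨0, 0, V.zero_mem, by simp⟩
      neg_mem' := by
        rintro x ⟨n, b, hb, e⟩
        refine ⟨n, (-1) ^ p ^ n * b, V.mul_mem _ _ (pow_mem (V.neg_mem _ V.one_mem) _) hb, ?_⟩
        rw [map_mul, e, neg_pow x]
        simp
      mem_or_inv_mem' := by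
        intro x
        obtain ⟨n, b, hb⟩ := hins x
        rcases V.mem_or_inv_mem b with h | h
        · exact Or.inl ⟨n, b, h, hb⟩
        · exact Or.inr ⟨n, b⁻¹, h, by rw [map_inv₀, hb, inv_pow]⟩ }
  refine ⟨W, ?_, ?_⟩
  · ext x
    rw [ValuationSubring.mem_comap]
    constructor
    · rintro ⟨n, b, hb, e⟩
      rw [← map_pow] at e
      rw [(algebraMap K L).injective e] at hb
      exact V.mem_of_pow_mem_aux x _ (hp0 n) hb
    · intro hx
      exact ⟨0, x, hx, by simp⟩
  · intro W' h
    ext a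
    exact key W' h a
end

section
/- Let V be a valuation ring and let R be a subring of V (equivalently, let R → V be an injective ring homomorphism) such that V is integral over R. Then the induced map on prime spectra Spec V → Spec R, sending a prime ideal of V to its contraction in R, is bijective. -/
/-- If `V` is a valuation ring and `R ⊆ V` a subring (an injective ring map `R → V`)
such that `V` is integral over `R`, then `Spec V → Spec R` is bijective. -/
theorem bijective_primeSpectrum_comap_of_integral_valuationRing
    (R V : Type*) [CommRing R] [CommRing V] [IsDomain V] [ValuationRing V]
    [Algebra R V] (hinj : Function.Injective (algebraMap R V))
    [Algebra.IsIntegral R V] :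
    Function.Bijective (PrimeSpectrum.comap (algebraMap R V)) := by
  constructor
  · intro p q h
    have h' : p.asIdeal.comap (algebraMap R V) = q.asIdeal.comap (algebraMap R V) :=
      congrArg PrimeSpectrum.asIdeal h
    apply PrimeSpectrum.ext
    by_contra hne
    rcases (ValuationRing.iff_ideal_total.mp ‹ValuationRing V›).total p.asIdeal q.asIdeal with hle | hle
    · exact (Ideal.IsIntegral.comap_lt_comap (R := R) (lt_of_le_of_ne hle hne)).ne h'
    · exact (Ideal.IsIntegral.comap_lt_comap (R := R) (lt_of_le_of_ne hle (Ne.symm hne))).ne h'.symm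
  · intro P
    obtain ⟨Q, hQ, hQP⟩ := Ideal.exists_ideal_over_prime_of_isIntegral_of_isDomain (S := V) P.asIdeal
      (by rw [(RingHom.injective_iff_ker_eq_bot _).mp hinj]; exact bot_le)
    exact ⟨⟨Q, hQ⟩, PrimeSpectrum.ext hQP⟩
end

section
/- Let p be a prime number, let V be a valuation ring of characteristic p, and let V' ⊆ V be a subring such that every element a ∈ V satisfies a^{p^n} ∈ V' for some n ∈ ℕ. Then the map Spec V → Spec V' is bijective; for every prime ideal 𝔭 of V', the unique prime ideal of V lying over 𝔭 is the radical √(𝔭V) of the extended ideal 𝔭V; and the induced ring extension V'/𝔭 → V/√(𝔭V) is purely inseparable in the sense that every element x of V/√(𝔭V) satisfies x^{p^n} ∈ image(V'/𝔭) for some n; consequently the residue field extension Frac(V'/𝔭) → Frac(V/√(𝔭V)) is purely inseparable. -/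
/-- Let `V` be a valuation ring of characteristic `p` and `V' ⊆ V` a subring such that every
`a ∈ V` has `a ^ p ^ n ∈ V'` for some `n`.  Then `Spec V → Spec V'` is bijective; for every
prime `𝔭` of `V'` the unique prime of `V` lying over `𝔭` is the radical `√(𝔭V)`; and the
extension `V'/𝔭 → V/√(𝔭V)` is purely inseparable: every element of `V/√(𝔭V)` has a
`p ^ n`-th power lying in the image of `V'` (equivalently, of `V'/𝔭`). -/
theorem valuationRing_spec_bijective_of_pow_mem
    (p : ℕ) (hp : p.Prime) (V : Type*) [CommRing V] [IsDomain V] [ValuationRing V]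
    [CharP V p] (V' : Subring V) (hpow : ∀ a : V, ∃ n : ℕ, a ^ p ^ n ∈ V') :
    Function.Bijective (PrimeSpectrum.comap V'.subtype) ∧
      ∀ 𝔭 : Ideal V', 𝔭.IsPrime →
        ((𝔭.map V'.subtype).radical.IsPrime ∧
          ((𝔭.map V'.subtype).radical).comap V'.subtype = 𝔭 ∧
          (∀ q : Ideal V, q.IsPrime → q.comap V'.subtype = 𝔭 →
            q = (𝔭.map V'.subtype).radical) ∧
          ∀ x : V ⧸ (𝔭.map V'.subtype).radical, ∃ n : ℕ,
            x ^ p ^ n ∈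
              ((Ideal.Quotient.mk ((𝔭.map V'.subtype).radical)).comp V'.subtype).range) := by
  have hpos : ∀ n : ℕ, 0 < p ^ n := fun n => pow_pos hp.pos n
  have hbij : Function.Bijective (PrimeSpectrum.comap V'.subtype) := by
    refine (PrimeSpectrum.isHomeomorph_comap V'.subtype (fun x => ?_) ?_).bijective
    · obtain ⟨n, hn⟩ := hpow x
      exact ⟨p ^ n, hpos n, ⟨x ^ p ^ n, hn⟩, rfl⟩
    · intro x hx
      have h0 : x = 0 := Subtype.ext (by simpa [RingHom.mem_ker] using hx)
      rw [h0]
      exact zero_mem _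
  refine ⟨hbij, fun 𝔭 h𝔭 => ?_⟩
  have key : ∀ q : Ideal V, q.IsPrime → q.comap V'.subtype = 𝔭 →
      q = (𝔭.map V'.subtype).radical := by
    intro q hq hqp
    apply le_antisymm
    · intro x hx
      obtain ⟨n, hn⟩ := hpow x
      refine ⟨p ^ n, ?_⟩
      have hmem : (⟨x ^ p ^ n, hn⟩ : V') ∈ 𝔭 := by
        rw [← hqp]
        exact Ideal.pow_mem_of_mem q hx _ (hpos n)
      exact Ideal.mem_map_of_mem V'.subtype hmem
    · exact hq.radical_le_iff.2 (Ideal.map_le_iff_le_comap.2 hqp.ge)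
  obtain ⟨q, hq⟩ := hbij.2 ⟨𝔭, h𝔭⟩
  have hqc : q.asIdeal.comap V'.subtype = 𝔭 := congrArg PrimeSpectrum.asIdeal hq
  have hqe := key q.asIdeal q.2 hqc
  refine ⟨hqe ▸ q.2, hqe ▸ hqc, key, fun x => ?_⟩
  obtain ⟨a, rfl⟩ := Ideal.Quotient.mk_surjective x
  obtain ⟨n, hn⟩ := hpow a
  exact ⟨n, ⟨a ^ p ^ n, hn⟩, by simp⟩
end

section
/- Let (C, ⊗, 1) be a symmetric monoidal category and V an object of C such that the internal hom objects [V, 1] and [V, V] exist (i.e. the functors W ↦ Hom_C(W ⊗ V, 1) and W ↦ Hom_C(W ⊗ V, V) are representable, represented by [V,1] and [V,V] with evaluation morphisms ev : [V,1] ⊗ V → 1 and ev' : [V,V] ⊗ V → V). Then V is dualizable if and only if the canonical morphism V ⊗ [V, 1] → [V, V], namely the morphism adjoint to the composite (V ⊗ [V,1]) ⊗ V ≅ V ⊗ ([V,1] ⊗ V) → V ⊗ 1 ≅ V induced by ev, is a split epimorphism (admits a section). -/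
open CategoryTheory MonoidalCategory

/-- Let `V` be an object of a symmetric monoidal category admitting internal homs
`[V, 𝟙] = H1` and `[V, V] = HV` (with their universal evaluation maps).  Then `V` is
dualizable if and only if the canonical morphism `V ⊗ [V, 𝟙] ⟶ [V, V]` — the morphism
adjoint to `(V ⊗ [V,𝟙]) ⊗ V ≅ V ⊗ ([V,𝟙] ⊗ V) ⟶ V ⊗ 𝟙 ≅ V` induced by evaluation —
is a split epimorphism. -/
theorem dualizable_iff_isSplitEpi_canonical
    {C : Type*} [Category C] [MonoidalCategory C] [SymmetricCategory C]
    (V H1 HV : C) (ev : H1 ⊗ V ⟶ 𝟙_ C) (ev' : HV ⊗ V ⟶ V)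
    (h1 : ∀ (W : C) (f : W ⊗ V ⟶ 𝟙_ C), ∃! g : W ⟶ H1, (g ▷ V) ≫ ev = f)
    (hV : ∀ (W : C) (f : W ⊗ V ⟶ V), ∃! g : W ⟶ HV, (g ▷ V) ≫ ev' = f)
    (m : V ⊗ H1 ⟶ HV)
    (hm : (m ▷ V) ≫ ev' = (α_ V H1 V).hom ≫ (V ◁ ev) ≫ (ρ_ V).hom) :
    (∃ W : C, Nonempty (ExactPairing V W)) ↔ IsSplitEpi m := by
  constructor
  · rintro ⟨W, ⟨p⟩⟩
    obtain ⟨φ, hφ, -⟩ := h1 W (ε_ V W)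
    have snake := ExactPairing.evaluation_coevaluation'' V W
    let s0 : HV ⟶ V ⊗ W := (ρ_ HV).inv ≫ HV ◁ η_ V W ≫ (α_ HV V W).inv ≫ ev' ▷ W
    have key : s0 ▷ V ≫ (α_ V W V).hom ≫ V ◁ ε_ V W ≫ (ρ_ V).hom = ev' := by
      calc
        _ = 𝟙 _ ⊗≫ HV ◁ η_ V W ▷ V ⊗≫ (ev' ▷ (W ⊗ V) ≫ V ◁ ε_ V W) ⊗≫ 𝟙 _ := by
          dsimp only [s0]; monoidal
        _ = 𝟙 _ ⊗≫ HV ◁ η_ V W ▷ V ⊗≫ ((HV ⊗ V) ◁ ε_ V W ≫ ev' ▷ 𝟙_ C) ⊗≫ 𝟙 _ := by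
          rw [whisker_exchange]
        _ = 𝟙 _ ⊗≫ HV ◁ (η_ V W ▷ V ⊗≫ V ◁ ε_ V W) ⊗≫ ev' ▷ 𝟙_ C ⊗≫ 𝟙 _ := by monoidal
        _ = ev' := by rw [snake]; monoidal
    refine IsSplitEpi.mk' ⟨s0 ≫ V ◁ φ, ?_⟩
    refine (hV HV ev').unique ?_ (by simp)
    calc
      _ = s0 ▷ V ≫ (V ◁ φ) ▷ V ≫ m ▷ V ≫ ev' := by simp
      _ = s0 ▷ V ≫ (α_ V W V).hom ≫ V ◁ (φ ▷ V ≫ ev) ≫ (ρ_ V).hom := by rw [hm]; simp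
      _ = ev' := by rw [hφ, key]
  · intro hs
    obtain ⟨⟨s, hsm⟩⟩ := hs.exists_splitEpi
    obtain ⟨n, hn, -⟩ := hV (𝟙_ C) (λ_ V).hom
    let η : 𝟙_ C ⟶ V ⊗ H1 := n ≫ s
    have snake : η ▷ V ≫ (α_ V H1 V).hom ≫ V ◁ ev ≫ (ρ_ V).hom = (λ_ V).hom := by
      rw [← hm, ← comp_whiskerRight_assoc]
      dsimp only [η]
      rw [Category.assoc, hsm, Category.comp_id, hn]
    have snake1 : η ▷ V ≫ (α_ V H1 V).hom ≫ V ◁ ev = (λ_ V).hom ≫ (ρ_ V).inv := by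
      rw [← snake]; simp
    have snake2 : (ρ_ H1).inv ≫ H1 ◁ η ≫ (α_ H1 V H1).inv ≫ ev ▷ H1 ≫ (λ_ H1).hom = 𝟙 H1 := by
      refine (h1 H1 ev).unique ?_ (by simp)
      calc
        _ = 𝟙 _ ⊗≫ H1 ◁ η ▷ V ⊗≫ (ev ▷ (H1 ⊗ V) ≫ 𝟙_ C ◁ ev) ⊗≫ 𝟙 _ := by monoidal
        _ = 𝟙 _ ⊗≫ H1 ◁ η ▷ V ⊗≫ ((H1 ⊗ V) ◁ ev ≫ ev ▷ 𝟙_ C) ⊗≫ 𝟙 _ := by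
          rw [whisker_exchange]
        _ = 𝟙 _ ⊗≫ H1 ◁ (η ▷ V ≫ (α_ V H1 V).hom ≫ V ◁ ev) ⊗≫ ev ▷ 𝟙_ C ⊗≫ 𝟙 _ := by
          monoidal
        _ = ev := by rw [snake1]; monoidal
    refine ⟨H1, ⟨⟨η, ev, ?_, snake1⟩⟩⟩
    rw [← cancel_mono (λ_ H1).hom, ← cancel_epi (ρ_ H1).inv]
    simpa using snake2
end
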